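/- arXiv:math/0303115 — 10 statements merged into one kernel-verified Lean document; each statement's English description precedes it below -/
import Mathlib

section
/- Under Property (D), for all integers r ≥ 0 and p ≥ r one has the submodule containments ∂_r(Z_r^{p-r}) + Z_{r-1}^{p+1} ⊆ Z_{r+1}^p + Z_{r-1}^{p+1} and ∂_r(Z_r^{p-r}) + Z_r^{p+1} ⊆ Z_{r+1}^p, and there is an isomorphism of R-modules (Z_{r+1}^p + Z_{r-1}^{p+1}) / (∂_r(Z_r^{p-r}) + Z_{r-1}^{p+1}) ≅ Z_{r+1}^p / (∂_r(Z_r^{p-r}) + Z_r^{p+1}). (This expresses that the cohomology H^p(E_r^·) of the induced differential on E_r^p = Z_r^p/(∂_{r-1}(Z_{r-1}^{p-r+1}) + Z_{r-1}^{p+1}) is canonically isomorphic to E_{r+1}^p.) -/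
/-- If `C ≤ A`, then `(A + B) / (C + B)` is isomorphic to `A / (C + A ∩ B)`. -/
theorem Submodule.nonempty_sup_quotient_equiv {R M : Type*} [Ring R] [AddCommGroup M]
    [Module R M] {A C : Submodule R M} (B : Submodule R M) (hC : C ≤ A) :
    Nonempty ((↥(A ⊔ B) ⧸ (C ⊔ B).comap (A ⊔ B).subtype) ≃ₗ[R]
      (↥A ⧸ (C ⊔ A ⊓ B).comap A.subtype)) := by
  let f : A →ₗ[R] ↥(A ⊔ B) ⧸ (C ⊔ B).comap (A ⊔ B).subtype :=
    (Submodule.mkQ _).comp (Submodule.inclusion le_sup_left)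
  have hker : LinearMap.ker f = (C ⊔ A ⊓ B).comap A.subtype := by
    ext ⟨x, hx⟩
    have hmod : C ⊔ A ⊓ B = (C ⊔ B) ⊓ A := by
      rw [inf_comm A B, sup_inf_assoc_of_le B hC]
    simp [f, hmod]
  have hf : Function.Surjective f := by
    intro y
    obtain ⟨⟨y, hy⟩, rfl⟩ := Submodule.mkQ_surjective _ y
    obtain ⟨a, ha, b, hb, rfl⟩ := Submodule.mem_sup.1 hy
    refine ⟨⟨a, ha⟩, (Submodule.Quotient.eq _).2 ?_⟩
    have hb' : -b ∈ C ⊔ B := neg_mem (Submodule.mem_sup_right hb)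
    simpa using hb'
  exact ⟨(f.quotKerEquivOfSurjective hf).symm.trans (Submodule.quotEquivOfEq _ _ hker)⟩

/-- Filtered module with a converging family of boundary operators, as in
Sanders, "Normal form theory and spectral sequences". -/

theorem stmt_0
    {R : Type*} [CommRing R] {M : Type*} [AddCommGroup M] [Module R M]
    (K : ℤ → Submodule R M)
    (hK : ∀ p : ℤ, 0 ≤ p → K (p + 1) ≤ K p)
    (D : ℤ → M →ₗ[R] M)
    (hDneg : D (-1) = 0)
    (hDK : ∀ r : ℤ, -1 ≤ r → ∀ p : ℤ, 0 ≤ p → ∀ x ∈ K p, D r x ∈ K p)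
    (hDD : ∀ r s : ℤ, -1 ≤ r → -1 ≤ s → (D r).comp (D s) = 0)
    (Z : ℤ → ℤ → Submodule R M)
    (hZ : ∀ r : ℤ, 0 ≤ r → ∀ p : ℤ, 0 ≤ p →
      Z r p = K p ⊓ (K (p + r)).comap (D r))
    (hZneg : ∀ p : ℤ, 0 ≤ p → Z (-1) p = K p)
    (hP : ∀ r : ℤ, 0 ≤ r → ∀ p : ℤ, 0 ≤ p → ∀ x : M,
      (x ∈ Z r p ∨ x ∈ Z (r - 1) p) → D r x - D (r - 1) x ∈ Z (r - 1) (p + r))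
    :
    ∀ r p : ℤ, 0 ≤ r → r ≤ p →
      ((Z r (p - r)).map (D r) ⊔ Z (r - 1) (p + 1) ≤ Z (r + 1) p ⊔ Z (r - 1) (p + 1)) ∧
      ((Z r (p - r)).map (D r) ⊔ Z r (p + 1) ≤ Z (r + 1) p) ∧
      Nonempty (
        (↥(Z (r + 1) p ⊔ Z (r - 1) (p + 1)) ⧸
          (((Z r (p - r)).map (D r) ⊔ Z (r - 1) (p + 1)).comap
            (Z (r + 1) p ⊔ Z (r - 1) (p + 1)).subtype))
        ≃ₗ[R]
        (↥(Z (r + 1) p) ⧸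
          (((Z r (p - r)).map (D r) ⊔ Z r (p + 1)).comap (Z (r + 1) p).subtype))) := by
  have mem_Z {r p : ℤ} (hr : -1 ≤ r) (hp : 0 ≤ p) (x : M) :
      x ∈ Z r p ↔ x ∈ K p ∧ D r x ∈ K (p + r) := by
    rcases hr.eq_or_lt with rfl | hr
    · simp [hZneg p hp, hDneg]
    · rw [hZ r (by omega) p hp]
      rfl
  intro r p hr hrp
  have hp : 0 ≤ p := hr.trans hrp
  have hCA : (Z r (p - r)).map (D r) ≤ Z (r + 1) p := by
    rintro _ ⟨x, hx, rfl⟩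
    have hx' := ((mem_Z (by omega) (by omega) x).1 hx).2
    have hDDx : D (r + 1) (D r x) = 0 :=
      LinearMap.congr_fun (hDD (r + 1) r (by omega) (by omega)) x
    rw [sub_add_cancel] at hx'
    refine (mem_Z (by omega) hp _).2 ⟨hx', ?_⟩
    rw [hDDx]
    exact zero_mem _
  have hdiff {x : M} (hx : x ∈ Z (r + 1) p ∨ x ∈ Z r p) :
      D (r + 1) x - D r x ∈ K (p + (r + 1)) := by
    have h := hP (r + 1) (by omega) p hp x (by rwa [add_sub_cancel_right])
    rw [add_sub_cancel_right] at h
    exact ((mem_Z (by omega) (by omega) _).1 h).1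
  have hZA : Z r (p + 1) ≤ Z (r + 1) p := by
    intro x hx
    obtain ⟨hxK, hxD⟩ := (mem_Z (by omega) (by omega) x).1 hx
    rw [show p + 1 + r = p + (r + 1) by ring] at hxD
    have hxr : x ∈ Z r p := by
      refine (mem_Z (by omega) hp x).2 ⟨hK p hp hxK, hK (p + r) (by omega) ?_⟩
      rwa [add_assoc]
    exact (mem_Z (by omega) hp x).2
      ⟨hK p hp hxK, (Submodule.sub_mem_iff_left _ hxD).1 (hdiff (Or.inr hxr))⟩
  have hZB : Z r (p + 1) ≤ Z (r - 1) (p + 1) := by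
    intro x hx
    obtain ⟨hxK, hxD⟩ := (mem_Z (by omega) (by omega) x).1 hx
    have h := ((mem_Z (by omega) (by omega) _).1
      (hP r hr (p + 1) (by omega) x (Or.inl hx))).1
    refine (mem_Z (by omega) (by omega) x).2 ⟨hxK, hK _ (by omega) ?_⟩
    rw [show p + 1 + (r - 1) + 1 = p + 1 + r by ring]
    exact (Submodule.sub_mem_iff_right _ hxD).1 h
  have hinf : Z (r + 1) p ⊓ Z (r - 1) (p + 1) = Z r (p + 1) := by
    refine le_antisymm ?_ (le_inf hZA hZB)
    rintro x ⟨hxA, hxB⟩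
    refine (mem_Z (by omega) (by omega) x).2
      ⟨((mem_Z (by omega) (by omega) x).1 hxB).1, ?_⟩
    rw [show p + 1 + r = p + (r + 1) by ring]
    exact (Submodule.sub_mem_iff_right _ ((mem_Z (by omega) hp x).1 hxA).2).1 (hdiff (Or.inl hxA))
  refine ⟨sup_le_sup_right hCA _, sup_le hCA hZA, ?_⟩
  rw [← hinf]
  exact Submodule.nonempty_sup_quotient_equiv _ hCA
end

section
/- For all integers r ≥ 0, p ≥ 0, and all z ∈ W ⊕ W, if z ∈ Z_r^p or z ∈ Z_{r-1}^p, then ∂_r z − ∂_{r-1} z ∈ Z_{r-1}^{p+r}. That is, the normal-form complex satisfies Property (D). -/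
/-- The normal-form complex `0 ← W ⊕ W ← 0` with boundary operators
`∂_r (x, y) = ([vʳ, y], 0)` satisfies Property (D). -/
theorem stmt_1
    {A : Type*} [CommRing A] [Algebra ℚ A]
    {W : Type*} [LieRing W] [LieAlgebra A W]
    (Wf : ℤ → Submodule A W)
    (hW0 : Wf 0 = ⊤)
    (hWmono : ∀ p : ℤ, 0 ≤ p → Wf (p + 1) ≤ Wf p)
    (hWbrack : ∀ i j : ℤ, 0 ≤ i → 0 ≤ j →
      ∀ x ∈ Wf i, ∀ y ∈ Wf j, ⁅x, y⁆ ∈ Wf (i + j))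
    (v : ℤ → W)
    (hv : ∀ r : ℤ, 1 ≤ r → v r - v (r - 1) ∈ Wf r)
    (D : ℤ → (W × W) →ₗ[A] (W × W))
    (hDneg : D (-1) = 0)
    (hD : ∀ r : ℤ, 0 ≤ r → ∀ z : W × W, D r z = (⁅v r, z.2⁆, 0))
    (K : ℤ → Submodule A (W × W))
    (hK : ∀ p : ℤ, K p = (Wf p).prod (Wf p))
    (Z : ℤ → ℤ → Submodule A (W × W))
    (hZ : ∀ r : ℤ, 0 ≤ r → ∀ p : ℤ, 0 ≤ p →
      Z r p = K p ⊓ (K (p + r)).comap (D r))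
    (hZneg : ∀ p : ℤ, 0 ≤ p → Z (-1) p = K p) :
    ∀ r : ℤ, 0 ≤ r → ∀ p : ℤ, 0 ≤ p → ∀ z : W × W,
      (z ∈ Z r p ∨ z ∈ Z (r - 1) p) →
        D r z - D (r - 1) z ∈ Z (r - 1) (p + r) := by
  intro r hr p hp z hz
  have hZK : ∀ s : ℤ, -1 ≤ s → Z s p ≤ K p := by
    intro s hs
    rcases hs.eq_or_lt with rfl | hs
    · exact (hZneg p hp).le
    · rw [hZ s (by omega) p hp]
      exact inf_le_left
  have hzK : z ∈ K p := hz.elim (fun h => hZK r (by omega) h) (fun h => hZK (r - 1) (by omega) h)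
  rw [hK, Submodule.mem_prod] at hzK
  rcases hr.eq_or_lt with rfl | hr'
  · rw [zero_sub, hDneg, hZneg _ (by omega), hD 0 le_rfl, hK, LinearMap.zero_apply, sub_zero,
      Submodule.mem_prod]
    refine ⟨?_, zero_mem _⟩
    rw [add_comm]
    exact hWbrack 0 p le_rfl hp _ (hW0 ▸ Submodule.mem_top) _ hzK.2
  · have hdiff : D r z - D (r - 1) z = (⁅v r - v (r - 1), z.2⁆, 0) := by
      rw [hD r hr, hD (r - 1) (by omega), Prod.mk_sub_mk, sub_zero, sub_lie]
    rw [hdiff, hZ (r - 1) (by omega) _ (by omega), Submodule.mem_inf, Submodule.mem_comap,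
      hD (r - 1) (by omega), lie_zero, hK, Submodule.mem_prod]
    refine ⟨⟨?_, zero_mem _⟩, zero_mem _⟩
    rw [add_comm]
    exact hWbrack r p hr hp _ (hv r (by omega)) _ hzK.2
end

section
/- Under Property (D), for all integers r ≥ 0 and p ≥ r one has ∂_r(∂_{r-1}(Z_{r-1}^{p-r+1}) + Z_{r-1}^{p+1}) ⊆ ∂_{r-1}(Z_{r-1}^{p+1}) + Z_{r-1}^{p+r+1}. (Hence ∂_r induces a well-defined map d_p^r : E_r^p → E_r^{p+r} on the quotients E_r^p = Z_r^p/(∂_{r-1}(Z_{r-1}^{p-r+1}) + Z_{r-1}^{p+1}).) -/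
/-- Filtered module with a converging family of boundary operators, as in
Sanders, "Normal form theory and spectral sequences". -/

theorem stmt_5
    {R : Type*} [CommRing R] {M : Type*} [AddCommGroup M] [Module R M]
    (K : ℤ → Submodule R M)
    (hK : ∀ p : ℤ, 0 ≤ p → K (p + 1) ≤ K p)
    (D : ℤ → M →ₗ[R] M)
    (hDneg : D (-1) = 0)
    (hDK : ∀ r : ℤ, -1 ≤ r → ∀ p : ℤ, 0 ≤ p → ∀ x ∈ K p, D r x ∈ K p)
    (hDD : ∀ r s : ℤ, -1 ≤ r → -1 ≤ s → (D r).comp (D s) = 0)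
    (Z : ℤ → ℤ → Submodule R M)
    (hZ : ∀ r : ℤ, 0 ≤ r → ∀ p : ℤ, 0 ≤ p →
      Z r p = K p ⊓ (K (p + r)).comap (D r))
    (hZneg : ∀ p : ℤ, 0 ≤ p → Z (-1) p = K p)
    (hP : ∀ r : ℤ, 0 ≤ r → ∀ p : ℤ, 0 ≤ p → ∀ x : M,
      (x ∈ Z r p ∨ x ∈ Z (r - 1) p) → D r x - D (r - 1) x ∈ Z (r - 1) (p + r))
    :
    ∀ r p : ℤ, 0 ≤ r → r ≤ p →
      ((Z (r - 1) (p - r + 1)).map (D (r - 1)) ⊔ Z (r - 1) (p + 1)).map (D r) ≤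
        (Z (r - 1) (p + 1)).map (D (r - 1)) ⊔ Z (r - 1) (p + r + 1) := by
  intro r p hr hrp
  rw [Submodule.map_sup, sup_le_iff]
  constructor
  · rw [← Submodule.map_comp, hDD r (r - 1) (by lia) (by lia), Submodule.map_zero]
    exact bot_le
  · rintro _ ⟨x, hx, rfl⟩
    have hdiff := hP r hr (p + 1) (by lia) x (Or.inr hx)
    rw [add_right_comm] at hdiff
    exact Submodule.mem_sup.mpr
      ⟨_, Submodule.mem_map_of_mem hx, _, hdiff, add_sub_cancel _ _⟩
end

section
/- Under Property (D), for all integers r ≥ 0, p ≥ 0 and every x ∈ Z_r^p, one has ∂_r x ∈ ∂_{r-1}(Z_{r-1}^{p+1}) + Z_{r-1}^{p+r+1} if and only if x ∈ Z_{r+1}^p + Z_{r-1}^{p+1}. (This identifies the p-cocycles of the induced differential on E_r^· .) -/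
/-- Filtered module with a converging family of boundary operators, as in
Sanders, "Normal form theory and spectral sequences". -/

theorem stmt_6
    {R : Type*} [CommRing R] {M : Type*} [AddCommGroup M] [Module R M]
    (K : ℤ → Submodule R M)
    (hK : ∀ p : ℤ, 0 ≤ p → K (p + 1) ≤ K p)
    (D : ℤ → M →ₗ[R] M)
    (hDneg : D (-1) = 0)
    (hDK : ∀ r : ℤ, -1 ≤ r → ∀ p : ℤ, 0 ≤ p → ∀ x ∈ K p, D r x ∈ K p)
    (hDD : ∀ r s : ℤ, -1 ≤ r → -1 ≤ s → (D r).comp (D s) = 0)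
    (Z : ℤ → ℤ → Submodule R M)
    (hZ : ∀ r : ℤ, 0 ≤ r → ∀ p : ℤ, 0 ≤ p →
      Z r p = K p ⊓ (K (p + r)).comap (D r))
    (hZneg : ∀ p : ℤ, 0 ≤ p → Z (-1) p = K p)
    (hP : ∀ r : ℤ, 0 ≤ r → ∀ p : ℤ, 0 ≤ p → ∀ x : M,
      (x ∈ Z r p ∨ x ∈ Z (r - 1) p) → D r x - D (r - 1) x ∈ Z (r - 1) (p + r))
    :
    ∀ r p : ℤ, 0 ≤ r → 0 ≤ p → ∀ x ∈ Z r p,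
      (D r x ∈ (Z (r - 1) (p + 1)).map (D (r - 1)) ⊔ Z (r - 1) (p + r + 1) ↔
        x ∈ Z (r + 1) p ⊔ Z (r - 1) (p + 1)) := by
  intro r p hr hp x hx
  have Z_le : ∀ s q : ℤ, -1 ≤ s → 0 ≤ q → Z s q ≤ K q := by
    intro s q hs hq
    obtain rfl | hs : s = -1 ∨ 0 ≤ s := by omega
    · exact (hZneg q hq).le
    · exact (hZ s hs q hq).trans_le inf_le_left
  have mem_Z_of_closed : ∀ s q : ℤ, -1 ≤ s → 0 ≤ q → ∀ w ∈ K q, D s w = 0 → w ∈ Z s q := by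
    intro s q hs hq w hw hw0
    obtain rfl | hs : s = -1 ∨ 0 ≤ s := by omega
    · rwa [hZneg q hq]
    · rw [hZ s hs q hq]
      exact ⟨hw, by simp [hw0]⟩
  have diff_succ : ∀ a : M, (a ∈ Z (r + 1) p ∨ a ∈ Z r p) →
      D (r + 1) a - D r a ∈ K (p + r + 1) := by
    intro a ha
    have h := hP (r + 1) (by omega) p hp a (by simpa using ha)
    rw [add_sub_cancel_right, ← add_assoc] at h
    exact Z_le r _ (by omega) (by omega) h
  have diff_pred : ∀ y ∈ Z (r - 1) (p + 1), D r y - D (r - 1) y ∈ Z (r - 1) (p + r + 1) := by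
    intro y hy
    have h := hP r hr (p + 1) (by omega) y (Or.inr hy)
    rwa [add_right_comm] at h
  simp only [Submodule.mem_sup, Submodule.mem_map]
  constructor
  · rintro ⟨_, ⟨y, hy, rfl⟩, z, hz, hxyz⟩
    have hxyK : x - y ∈ K p :=
      sub_mem (Z_le r p (by omega) hp hx) (hK p hp (Z_le _ _ (by omega) (by omega) hy))
    have hD : D r (x - y) ∈ K (p + r + 1) := by
      have h := Z_le _ _ (by omega) (by omega) (sub_mem hz (diff_pred y hy))
      rwa [show z - (D r y - D (r - 1) y) = D r (x - y) by
        rw [map_sub, ← hxyz]; abel] at h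
    have hxyZ : x - y ∈ Z r p := by
      rw [hZ r hr p hp]
      exact ⟨hxyK, hK (p + r) (by omega) hD⟩
    refine ⟨x - y, ?_, y, hy, sub_add_cancel x y⟩
    rw [hZ (r + 1) (by omega) p hp, ← add_assoc]
    refine ⟨hxyK, ?_⟩
    simpa using add_mem (diff_succ _ (Or.inr hxyZ)) hD
  · rintro ⟨a, ha, y, hy, rfl⟩
    have haK : D (r + 1) a ∈ K (p + r + 1) := by
      have h := ha
      rw [hZ (r + 1) (by omega) p hp, ← add_assoc] at h
      exact h.2
    have hD : D r a ∈ K (p + r + 1) := by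
      simpa using sub_mem haK (diff_succ a (Or.inl ha))
    have haZ : D r a ∈ Z (r - 1) (p + r + 1) :=
      mem_Z_of_closed _ _ (by omega) (by omega) _ hD
        (LinearMap.congr_fun (hDD (r - 1) r (by omega) (by omega)) a)
    refine ⟨_, ⟨y, hy, rfl⟩, _, add_mem haZ (diff_pred y hy), ?_⟩
    rw [map_add]
    abel
end

section
/- Under Property (D), for all integers r ≥ 0 and p ≥ 0 one has the equality of submodules Z_{r+1}^p ∩ Z_{r-1}^{p+1} = Z_r^{p+1}. -/
/-- Filtered module with a converging family of boundary operators, as in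
Sanders, "Normal form theory and spectral sequences". -/

theorem stmt_7
    {R : Type*} [CommRing R] {M : Type*} [AddCommGroup M] [Module R M]
    (K : ℤ → Submodule R M)
    (hK : ∀ p : ℤ, 0 ≤ p → K (p + 1) ≤ K p)
    (D : ℤ → M →ₗ[R] M)
    (hDneg : D (-1) = 0)
    (hDK : ∀ r : ℤ, -1 ≤ r → ∀ p : ℤ, 0 ≤ p → ∀ x ∈ K p, D r x ∈ K p)
    (hDD : ∀ r s : ℤ, -1 ≤ r → -1 ≤ s → (D r).comp (D s) = 0)
    (Z : ℤ → ℤ → Submodule R M)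
    (hZ : ∀ r : ℤ, 0 ≤ r → ∀ p : ℤ, 0 ≤ p →
      Z r p = K p ⊓ (K (p + r)).comap (D r))
    (hZneg : ∀ p : ℤ, 0 ≤ p → Z (-1) p = K p)
    (hP : ∀ r : ℤ, 0 ≤ r → ∀ p : ℤ, 0 ≤ p → ∀ x : M,
      (x ∈ Z r p ∨ x ∈ Z (r - 1) p) → D r x - D (r - 1) x ∈ Z (r - 1) (p + r))
    :
    ∀ r p : ℤ, 0 ≤ r → 0 ≤ p → Z (r + 1) p ⊓ Z (r - 1) (p + 1) = Z r (p + 1) := by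
  intro r p hr hp
  have hZK : ∀ s : ℤ, -1 ≤ s → ∀ q : ℤ, 0 ≤ q → Z s q ≤ K q := by
    intro s hs q hq
    obtain rfl | hs' : s = -1 ∨ 0 ≤ s := by omega
    · exact (hZneg q hq).le
    · rw [hZ s hs' q hq]
      exact inf_le_left
  have hZD : ∀ s : ℤ, 0 ≤ s → ∀ q : ℤ, 0 ≤ q → ∀ x : M,
      x ∈ Z s q ↔ x ∈ K q ∧ D s x ∈ K (q + s) := by
    intro s hs q hq x
    rw [hZ s hs q hq, Submodule.mem_inf, Submodule.mem_comap]
  ext x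
  rw [Submodule.mem_inf]
  constructor
  · rintro ⟨hx, hx'⟩
    refine (hZD r hr (p + 1) (by omega) x).2 ⟨hZK (r - 1) (by omega) (p + 1) (by omega) hx', ?_⟩
    have hdiff := hZK _ (by omega) _ (by omega) (hP (r + 1) (by omega) p hp x (Or.inl hx))
    have hmem := sub_mem ((hZD (r + 1) (by omega) p hp x).1 hx).2 hdiff
    rwa [sub_sub_cancel, add_sub_cancel_right, show p + (r + 1) = p + 1 + r by ring] at hmem
  · intro hx
    obtain ⟨hxK, hxD⟩ := (hZD r hr (p + 1) (by omega) x).1 hx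
    constructor
    · refine (hZD (r + 1) (by omega) p hp x).2 ⟨hK p hp hxK, ?_⟩
      have hdiff := hZK _ (by omega) _ (by omega)
        (hP (r + 1) (by omega) (p + 1) (by omega) x (Or.inr (by rwa [add_sub_cancel_right])))
      rw [add_sub_cancel_right, ← add_assoc] at hdiff
      have hmem := add_mem (hK _ (by omega) hdiff) hxD
      rwa [sub_add_cancel, show p + 1 + r = p + (r + 1) by ring] at hmem
    · obtain rfl | hr' : r = 0 ∨ 0 ≤ r - 1 := by omega
      · rwa [zero_sub, hZneg (p + 1) (by omega)]
      · refine (hZD (r - 1) hr' (p + 1) (by omega) x).2 ⟨hxK, hK _ (by omega) ?_⟩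
        have hdiff := hZK _ (by omega) _ (by omega)
          (hP r hr (p + 1) (by omega) x (Or.inl hx))
        have hmem := sub_mem hxD hdiff
        rwa [sub_sub_cancel, show p + 1 + r = p + 1 + (r - 1) + 1 by ring] at hmem
end

section
/- Under Property (D), for all integers r ≥ 0 and p ≥ r one has ∂_{r-1}(Z_{r-1}^{p-r+1}) ⊆ ∂_r(Z_r^{p-r}) + Z_{r-1}^{p+1}. (Hence the space of p-coboundaries of the induced differential on E_r^· equals (∂_r(Z_r^{p-r}) + Z_{r-1}^{p+1})/(∂_{r-1}(Z_{r-1}^{p-r+1}) + Z_{r-1}^{p+1}).) -/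
/-- Filtered module with a converging family of boundary operators, as in
Sanders, "Normal form theory and spectral sequences". -/

theorem stmt_9
    {R : Type*} [CommRing R] {M : Type*} [AddCommGroup M] [Module R M]
    (K : ℤ → Submodule R M)
    (hK : ∀ p : ℤ, 0 ≤ p → K (p + 1) ≤ K p)
    (D : ℤ → M →ₗ[R] M)
    (hDneg : D (-1) = 0)
    (hDK : ∀ r : ℤ, -1 ≤ r → ∀ p : ℤ, 0 ≤ p → ∀ x ∈ K p, D r x ∈ K p)
    (hDD : ∀ r s : ℤ, -1 ≤ r → -1 ≤ s → (D r).comp (D s) = 0)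
    (Z : ℤ → ℤ → Submodule R M)
    (hZ : ∀ r : ℤ, 0 ≤ r → ∀ p : ℤ, 0 ≤ p →
      Z r p = K p ⊓ (K (p + r)).comap (D r))
    (hZneg : ∀ p : ℤ, 0 ≤ p → Z (-1) p = K p)
    (hP : ∀ r : ℤ, 0 ≤ r → ∀ p : ℤ, 0 ≤ p → ∀ x : M,
      (x ∈ Z r p ∨ x ∈ Z (r - 1) p) → D r x - D (r - 1) x ∈ Z (r - 1) (p + r))
    :
    ∀ r p : ℤ, 0 ≤ r → r ≤ p →
      (Z (r - 1) (p - r + 1)).map (D (r - 1)) ≤ (Z r (p - r)).map (D r) ⊔ Z (r - 1) (p + 1) := by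
  intro r p hr hrp
  have hZK : ∀ q : ℤ, 0 ≤ q → Z (r - 1) q ≤ K q := by
    intro q hq
    rcases hr.eq_or_lt with rfl | hr
    · exact (hZneg q hq).le
    · rw [hZ (r - 1) (by lia) q hq]
      exact inf_le_left
  rintro _ ⟨x, hx, rfl⟩
  have hdiff : D r x - D (r - 1) x ∈ Z (r - 1) (p + 1) := by
    have h := hP r hr (p - r + 1) (by lia) x (Or.inr hx)
    rwa [show p - r + 1 + r = p + 1 by ring] at h
  have hprev : D (r - 1) x ∈ K p := by
    rcases hr.eq_or_lt with rfl | hr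
    · simp [hDneg]
    · have hx' : x ∈ Z (r - 1) (p - r + 1) := hx
      rw [hZ (r - 1) (by lia) _ (by lia)] at hx'
      have h : D (r - 1) x ∈ K (p - r + 1 + (r - 1)) := hx'.2
      rwa [show p - r + 1 + (r - 1) = p by ring] at h
  have hcur : D r x ∈ K p := by
    have h := hK p (by lia) (hZK _ (by lia) hdiff)
    simpa using add_mem h hprev
  have hxZ : x ∈ Z r (p - r) := by
    rw [hZ r hr _ (by lia), show p - r + r = p by ring]
    exact ⟨hK _ (by lia) (hZK _ (by lia) hx), hcur⟩
  exact Submodule.mem_sup.2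
    ⟨D r x, Submodule.mem_map_of_mem hxZ, -(D r x - D (r - 1) x), neg_mem hdiff, by abel⟩
end

section
/- For all integers k ≥ −1, l ≥ 0 and q ∈ ℤ, the commutator of derivations satisfies [A(0,0,1), A(k,l,q)] = (k − l) · A(k,l,q+1). -/
open MvPolynomial in
/-- The derivation `A_{k+l}^{k-l,q} = i^q (x^{k+1} y^l ∂_x + i^{2q} x^l y^{k+1} ∂_y)`
on `ℂ[x,y]`, determined by `A(k,l,q)(x) = i^q x^{k+1} y^l` and
`A(k,l,q)(y) = i^{3q} x^l y^{k+1}`. -/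
noncomputable def anharmonicA (k l q : ℤ) :
    Derivation ℂ (MvPolynomial (Fin 2) ℂ) (MvPolynomial (Fin 2) ℂ) :=
  MvPolynomial.mkDerivation ℂ (fun j : Fin 2 =>
    if j = 0 then Complex.I ^ q • (X 0 ^ (k + 1).toNat * X 1 ^ l.toNat)
    else Complex.I ^ (3 * q) • (X 0 ^ l.toNat * X 1 ^ (k + 1).toNat))

open MvPolynomial in
theorem anharmonicA_apply_X_zero (k l q : ℤ) :
    anharmonicA k l q (X 0) = Complex.I ^ q • (X 0 ^ (k + 1).toNat * X 1 ^ l.toNat) := by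
  simp [anharmonicA, mkDerivation_X]

open MvPolynomial in
theorem anharmonicA_apply_X_one (k l q : ℤ) :
    anharmonicA k l q (X 1) = Complex.I ^ (3 * q) • (X 0 ^ l.toNat * X 1 ^ (k + 1).toNat) := by
  simp [anharmonicA, mkDerivation_X]

open MvPolynomial in
theorem anharmonicA_zero_zero_one_apply_X_zero :
    anharmonicA 0 0 1 (X 0) = Complex.I • X 0 := by
  simp [anharmonicA_apply_X_zero]

theorem Complex.I_zpow_three : Complex.I ^ (3 : ℤ) = -Complex.I := by
  exact_mod_cast Complex.I_pow_three

open MvPolynomial in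
theorem anharmonicA_zero_zero_one_apply_X_one :
    anharmonicA 0 0 1 (X 1) = (-Complex.I) • X 1 := by
  simp [anharmonicA_apply_X_one]

/-- A derivation scales the powers of an eigenvector. -/
theorem Derivation.apply_pow_of_apply_eq_smul {R A : Type*} [CommRing R] [CommRing A] [Algebra R A]
    (D : Derivation R A A) {a : A} {c : R} (h : D a = c • a) (n : ℕ) :
    D (a ^ n) = ((n : R) * c) • a ^ n := by
  induction n with
  | zero => simp
  | succ n ih =>
    rw [pow_succ, D.leibniz, ih, h]
    simp only [smul_eq_mul, Algebra.smul_def, map_mul, map_add, map_one, Nat.cast_succ]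
    ring

open MvPolynomial in
/-- Monomials are eigenvectors of the linear part of the anharmonic oscillator. -/
theorem anharmonicA_zero_zero_one_apply_monomial (a b : ℕ) :
    anharmonicA 0 0 1 (X 0 ^ a * X 1 ^ b) =
      (((a : ℂ) - b) * Complex.I) • (X 0 ^ a * X 1 ^ b) := by
  rw [Derivation.leibniz,
    Derivation.apply_pow_of_apply_eq_smul _ anharmonicA_zero_zero_one_apply_X_zero,
    Derivation.apply_pow_of_apply_eq_smul _ anharmonicA_zero_zero_one_apply_X_one]
  simp only [smul_eq_mul, Algebra.smul_def, map_mul, map_sub, map_neg, map_natCast]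
  ring

/-- `[A(0,0,1), A(k,l,q)] = (k - l) A(k,l,q+1)`. -/
theorem stmt_11 (k l q : ℤ) (hk : -1 ≤ k) (hl : 0 ≤ l) :
    ⁅anharmonicA 0 0 1, anharmonicA k l q⁆ =
      ((k - l : ℤ) : ℂ) • anharmonicA k l (q + 1) := by
  have hk' : (((k + 1).toNat : ℕ) : ℂ) = k + 1 := by
    exact_mod_cast congrArg (Int.cast : ℤ → ℂ) (Int.toNat_of_nonneg (by omega : 0 ≤ k + 1))
  have hl' : ((l.toNat : ℕ) : ℂ) = l := by
    exact_mod_cast congrArg (Int.cast : ℤ → ℂ) (Int.toNat_of_nonneg hl)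
  refine MvPolynomial.derivation_ext fun j => ?_
  fin_cases j
  · simp only [Fin.zero_eta]
    rw [Derivation.commutator_apply, anharmonicA_zero_zero_one_apply_X_zero]
    simp only [Derivation.smul_apply, Derivation.map_smul, anharmonicA_apply_X_zero,
      anharmonicA_zero_zero_one_apply_monomial,
      smul_smul, ← sub_smul, hk', hl', zpow_add₀ Complex.I_ne_zero, zpow_one]
    congr 1
    push_cast
    ring
  · simp only [Fin.mk_one]
    rw [Derivation.commutator_apply, anharmonicA_zero_zero_one_apply_X_one]
    simp only [Derivation.smul_apply, Derivation.map_smul, anharmonicA_apply_X_one,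
      anharmonicA_zero_zero_one_apply_monomial,
      smul_smul, ← sub_smul, hk', hl', mul_add, zpow_add₀ Complex.I_ne_zero, mul_one,
      Complex.I_zpow_three]
    congr 1
    push_cast
    ring
end

section
/- For all integers k, m ≥ −1, l, n ≥ 0 and p, q ∈ ℤ, the commutator of derivations satisfies [A(k,l,p), A(m,n,q)] = (m − k) · A(k+m, l+n, p+q) + n · A(m+l, n+k, q−p) − l · A(k+n, l+m, p−q), with the convention that any term whose integer coefficient is zero is interpreted as 0 (even if its first index would fall below −1 or its second index below 0). -/
theorem Complex.I_zpow_three_mul (q : ℤ) : Complex.I ^ (3 * q) = (Complex.I ^ q)⁻¹ := by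
  rw [zpow_mul, ← inv_zpow]
  congr 1
  rw [Complex.inv_I]
  exact_mod_cast Complex.I_pow_three

theorem anharmonicA_X_zero (k l q : ℤ) :
    anharmonicA k l q (MvPolynomial.X 0) = MvPolynomial.C (Complex.I ^ q) *
      (MvPolynomial.X 0 ^ (k + 1).toNat * MvPolynomial.X 1 ^ l.toNat) := by
  simp [anharmonicA, MvPolynomial.mkDerivation_X, MvPolynomial.smul_eq_C_mul]

theorem anharmonicA_X_one (k l q : ℤ) :
    anharmonicA k l q (MvPolynomial.X 1) = MvPolynomial.C (Complex.I ^ q)⁻¹ *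
      (MvPolynomial.X 0 ^ l.toNat * MvPolynomial.X 1 ^ (k + 1).toNat) := by
  simp [anharmonicA, MvPolynomial.mkDerivation_X, MvPolynomial.smul_eq_C_mul,
    Complex.I_zpow_three_mul]

theorem natCast_mul_pow_pred_mul_pow {R : Type*} [CommSemiring R] (x : R) (a b : ℕ) :
    (a : R) * x ^ (a - 1) * x ^ b = a * x ^ (a + b - 1) := by
  rcases a with _ | a
  · simp
  · rw [mul_assoc, ← pow_add]
    congr 2
    omega

/-- The Leibniz rule for a scaled monomial in two polynomials. -/
theorem Derivation.leibniz_C_mul_pow_mul_pow {σ : Type*}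
    (D : Derivation ℂ (MvPolynomial σ ℂ) (MvPolynomial σ ℂ)) (c : ℂ)
    (x y : MvPolynomial σ ℂ) (a b : ℕ) :
    D (MvPolynomial.C c * (x ^ a * y ^ b)) = MvPolynomial.C c *
      ((a : MvPolynomial σ ℂ) * x ^ (a - 1) * y ^ b * D x +
        (b : MvPolynomial σ ℂ) * y ^ (b - 1) * x ^ a * D y) := by
  rw [← MvPolynomial.smul_eq_C_mul, ← MvPolynomial.smul_eq_C_mul, D.map_smul, D.leibniz,
    D.leibniz_pow, D.leibniz_pow]
  simp only [smul_eq_mul, nsmul_eq_mul]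
  congr 1
  ring

/-- The general commutation relation
`[A(k,l,p), A(m,n,q)] = (m-k) A(k+m,l+n,p+q) + n A(m+l,n+k,q-p) - l A(k+n,l+m,p-q)`;
whenever an index of a term falls out of range its integer coefficient vanishes, so the
term is zero, in accordance with the stated convention. -/
theorem stmt_12 (k m l n p q : ℤ) (hk : -1 ≤ k) (hm : -1 ≤ m) (hl : 0 ≤ l) (hn : 0 ≤ n) :
    ⁅anharmonicA k l p, anharmonicA m n q⁆ =
      ((m - k : ℤ) : ℂ) • anharmonicA (k + m) (l + n) (p + q) +
        ((n : ℤ) : ℂ) • anharmonicA (m + l) (n + k) (q - p) -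
        ((l : ℤ) : ℂ) • anharmonicA (k + n) (l + m) (p - q) := by
  obtain ⟨K, rfl⟩ : ∃ K : ℕ, k = K - 1 := ⟨(k + 1).toNat, by omega⟩
  obtain ⟨M, rfl⟩ : ∃ M : ℕ, m = M - 1 := ⟨(m + 1).toNat, by omega⟩
  lift l to ℕ using hl
  lift n to ℕ using hn
  have hK : ((K : ℤ) - 1 + 1).toNat = K := by omega
  have hM : ((M : ℤ) - 1 + 1).toNat = M := by omega
  have hKM : ((K : ℤ) - 1 + (M - 1) + 1).toNat = K + M - 1 := by omega
  have hln : ((l : ℤ) + n).toNat = l + n := by omega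
  have hMl : ((M : ℤ) - 1 + l + 1).toNat = M + l := by omega
  have hnK : ((n : ℤ) + (K - 1)).toNat = n + K - 1 := by omega
  have hKn : ((K : ℤ) - 1 + n + 1).toNat = K + n := by omega
  have hlM : ((l : ℤ) + (M - 1)).toNat = l + M - 1 := by omega
  have hadd := zpow_add₀ Complex.I_ne_zero p q
  have hsub := zpow_sub₀ Complex.I_ne_zero p q
  have hsub' := zpow_sub₀ Complex.I_ne_zero q p
  have hC : ∀ z : ℤ, (MvPolynomial.C (z : ℂ) : MvPolynomial (Fin 2) ℂ) = z :=
    fun z => map_intCast _ z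
  apply MvPolynomial.derivation_ext
  intro j
  have key := @natCast_mul_pow_pred_mul_pow (MvPolynomial (Fin 2) ℂ) _
  fin_cases j
  · simp only [Fin.zero_eta, Derivation.commutator_apply, Derivation.add_apply, Derivation.sub_apply,
      Derivation.smul_apply, anharmonicA_X_zero, anharmonicA_X_one,
      Derivation.leibniz_C_mul_pow_mul_pow, MvPolynomial.smul_eq_C_mul, hK, hM, hKM, hln, hMl, hnK,
      hKn, hlM, hadd, hsub, hsub', Int.toNat_natCast, hC, div_eq_mul_inv, map_mul]
    have h1 := key (.X 0) M K
    have h2 := key (.X 0) K M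
    have h3 := key (.X 1) n K
    have h4 := key (.X 1) l M
    rw [Nat.add_comm M K] at h1
    push_cast
    generalize MvPolynomial.C (Complex.I ^ p) = a at *
    generalize MvPolynomial.C (Complex.I ^ q) = b at *
    generalize MvPolynomial.C (Complex.I ^ p)⁻¹ = a' at *
    generalize MvPolynomial.C (Complex.I ^ q)⁻¹ = b' at *
    simp only [pow_add]
    linear_combination (a * b * .X 1 ^ l * .X 1 ^ n) * (h1 - h2) +
      (b * a' * .X 0 ^ M * .X 0 ^ l) * h3 - (a * b' * .X 0 ^ K * .X 0 ^ n) * h4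
  · simp only [Fin.mk_one, Derivation.commutator_apply, Derivation.add_apply, Derivation.sub_apply,
      Derivation.smul_apply, anharmonicA_X_zero, anharmonicA_X_one,
      Derivation.leibniz_C_mul_pow_mul_pow, MvPolynomial.smul_eq_C_mul, hK, hM, hKM, hln, hMl, hnK,
      hKn, hlM, hadd, hsub, hsub', Int.toNat_natCast, hC, div_eq_mul_inv, map_mul, mul_inv, inv_inv]
    have h1 := key (.X 1) M K
    have h2 := key (.X 1) K M
    have h3 := key (.X 0) n K
    have h4 := key (.X 0) l M
    rw [Nat.add_comm M K] at h1
    push_cast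
    generalize MvPolynomial.C (Complex.I ^ p) = a at *
    generalize MvPolynomial.C (Complex.I ^ q) = b at *
    generalize MvPolynomial.C (Complex.I ^ p)⁻¹ = a' at *
    generalize MvPolynomial.C (Complex.I ^ q)⁻¹ = b' at *
    simp only [pow_add]
    linear_combination (a' * b' * .X 0 ^ l * .X 0 ^ n) * (h1 - h2) +
      (b' * a * .X 1 ^ M * .X 1 ^ l) * h3 - (a' * b * .X 1 ^ K * .X 1 ^ n) * h4
end

section
/- For all integers k, m ≥ 0, the derivations A(k,k,q) satisfy the commutation relations: [A(k,k,0), A(m,m,0)] = 2(m − k) · A(k+m, k+m, 0); [A(k,k,0), A(m,m,1)] = 2m · A(k+m, k+m, 1); and [A(k,k,1), A(m,m,1)] = 0. -/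
open MvPolynomial in
theorem anharmonicA_diag_X_zero (n : ℕ) (q : ℤ) :
    anharmonicA n n q (X 0) = C (Complex.I ^ q) * (X 0 * (X 0 * X 1) ^ n) := by
  simp only [anharmonicA, mkDerivation_X, if_true, smul_eq_C_mul,
    Int.toNat_natCast_add_one, Int.toNat_natCast]
  ring

open MvPolynomial in
theorem anharmonicA_diag_X_one (n : ℕ) (q : ℤ) :
    anharmonicA n n q (X 1) = C (Complex.I ^ (3 * q)) * (X 1 * (X 0 * X 1) ^ n) := by
  simp only [anharmonicA, mkDerivation_X, one_ne_zero, if_false, smul_eq_C_mul,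
    Int.toNat_natCast_add_one, Int.toNat_natCast]
  ring

open MvPolynomial in
/-- A diagonal element acts on powers of `xy` by a scalar and a shift of the exponent. -/
theorem anharmonicA_diag_mul_pow (n m : ℕ) (q : ℤ) :
    anharmonicA n n q ((X 0 * X 1) ^ m) =
      C (m * (Complex.I ^ q + Complex.I ^ (3 * q))) * (X 0 * X 1) ^ (n + m) := by
  rcases m with _ | m
  · simp
  · simp only [Derivation.leibniz_pow, Derivation.leibniz, anharmonicA_diag_X_zero,
      anharmonicA_diag_X_one, smul_eq_mul, nsmul_eq_mul, map_mul, map_add, map_natCast,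
      Nat.add_sub_cancel]
    ring

open MvPolynomial in
/-- The commutator of two diagonal elements, evaluated on the variable `x`. -/
theorem anharmonicA_diag_lie_X_zero (n m : ℕ) (p q : ℤ) :
    ⁅anharmonicA n n p, anharmonicA m m q⁆ (X 0) =
      C (Complex.I ^ q * m * (Complex.I ^ p + Complex.I ^ (3 * p)) -
        Complex.I ^ p * n * (Complex.I ^ q + Complex.I ^ (3 * q))) *
        (X 0 * (X 0 * X 1) ^ (n + m)) := by
  simp only [Derivation.commutator_apply, anharmonicA_diag_X_zero, Derivation.leibniz,
    anharmonicA_diag_mul_pow, derivation_C, smul_eq_mul, map_mul, map_add, map_sub,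
    map_natCast]
  ring

open MvPolynomial in
/-- The commutator of two diagonal elements, evaluated on the variable `y`. -/
theorem anharmonicA_diag_lie_X_one (n m : ℕ) (p q : ℤ) :
    ⁅anharmonicA n n p, anharmonicA m m q⁆ (X 1) =
      C (Complex.I ^ (3 * q) * m * (Complex.I ^ p + Complex.I ^ (3 * p)) -
        Complex.I ^ (3 * p) * n * (Complex.I ^ q + Complex.I ^ (3 * q))) *
        (X 1 * (X 0 * X 1) ^ (n + m)) := by
  simp only [Derivation.commutator_apply, anharmonicA_diag_X_one, Derivation.leibniz,
    anharmonicA_diag_mul_pow, derivation_C, smul_eq_mul, map_mul, map_add, map_sub,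
    map_natCast]
  ring

/-- The commutation relations among the diagonal elements `A_{2k}^{0,q} = A(k,k,q)`. -/
theorem stmt_13 (k m : ℤ) (hk : 0 ≤ k) (hm : 0 ≤ m) :
    ⁅anharmonicA k k 0, anharmonicA m m 0⁆ =
        ((2 * (m - k) : ℤ) : ℂ) • anharmonicA (k + m) (k + m) 0 ∧
      ⁅anharmonicA k k 0, anharmonicA m m 1⁆ =
        ((2 * m : ℤ) : ℂ) • anharmonicA (k + m) (k + m) 1 ∧
      ⁅anharmonicA k k 1, anharmonicA m m 1⁆ = 0 := by
  lift k to ℕ using hk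
  lift m to ℕ using hm
  have hI : Complex.I ^ (3 : ℤ) = -Complex.I := by
    exact_mod_cast Complex.I_pow_three
  rw [← Nat.cast_add]
  refine ⟨?_, ?_, ?_⟩ <;> refine MvPolynomial.derivation_ext fun j => ?_ <;> fin_cases j <;>
    simp only [Fin.zero_eta, Fin.mk_one, Derivation.smul_apply, Derivation.zero_apply,
      anharmonicA_diag_lie_X_zero, anharmonicA_diag_lie_X_one, anharmonicA_diag_X_zero,
      anharmonicA_diag_X_one, MvPolynomial.smul_eq_C_mul, ← mul_assoc, ← map_mul,
      mul_zero, mul_one, zpow_zero, zpow_one, hI] <;>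
    first
    | (simp; done)
    | (congr 3; push_cast; ring1)
end

section
/- The ℂ-linear span L of {A(m,m,q) : m ∈ ℕ, q ∈ {0,1}} is a Lie subalgebra of the Lie algebra of ℂ-linear derivations of ℂ[x,y], and the ℂ-linear span 𝒜 of {A(m,m,1) : m ∈ ℕ} is an abelian Lie ideal of L (i.e. [𝒜, 𝒜] = 0 and [L, 𝒜] ⊆ 𝒜). -/
open MvPolynomial

theorem anharmonicA_zero_X_zero (m : ℕ) :
    anharmonicA m m 0 (X 0) = (X 0 * X 1) ^ m * X 0 := by
  simp only [anharmonicA, mkDerivation_X, if_true, zpow_zero, one_smul, Int.toNat_natCast,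
    Int.toNat_natCast_add_one]
  ring

theorem anharmonicA_zero_X_one (m : ℕ) :
    anharmonicA m m 0 (X 1) = (X 0 * X 1) ^ m * X 1 := by
  simp only [anharmonicA, mkDerivation_X, one_ne_zero, if_false, mul_zero, zpow_zero, one_smul,
    Int.toNat_natCast, Int.toNat_natCast_add_one]
  ring

theorem anharmonicA_one_X_zero (m : ℕ) :
    anharmonicA m m 1 (X 0) = C Complex.I * ((X 0 * X 1) ^ m * X 0) := by
  simp only [anharmonicA, mkDerivation_X, if_true, zpow_one, Int.toNat_natCast,
    Int.toNat_natCast_add_one, smul_eq_C_mul]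
  ring

theorem anharmonicA_one_X_one (m : ℕ) :
    anharmonicA m m 1 (X 1) = -(C Complex.I * ((X 0 * X 1) ^ m * X 1)) := by
  have hI : Complex.I ^ (3 * 1 : ℤ) = -Complex.I := by
    rw [mul_one]
    exact_mod_cast Complex.I_pow_three
  simp only [anharmonicA, mkDerivation_X, one_ne_zero, if_false, hI, Int.toNat_natCast,
    Int.toNat_natCast_add_one, smul_eq_C_mul, C_neg]
  ring

theorem anharmonicA_zero_pow (m n : ℕ) :
    anharmonicA m m 0 ((X 0 * X 1) ^ n) =
      2 * (n : MvPolynomial (Fin 2) ℂ) * (X 0 * X 1) ^ (m + n) := by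
  rcases n with _ | n
  · simp
  · simp only [Derivation.leibniz_pow, Derivation.leibniz, anharmonicA_zero_X_zero,
      anharmonicA_zero_X_one, smul_eq_mul, nsmul_eq_mul, Nat.add_sub_cancel]
    push_cast
    ring

theorem anharmonicA_one_pow (m n : ℕ) :
    anharmonicA m m 1 ((X 0 * X 1) ^ n) = 0 := by
  simp only [Derivation.leibniz_pow, Derivation.leibniz, anharmonicA_one_X_zero,
    anharmonicA_one_X_one, smul_eq_mul, nsmul_eq_mul]
  ring

theorem lie_anharmonicA_zero_zero (m n : ℕ) :
    ⁅anharmonicA m m 0, anharmonicA n n 0⁆ =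
      (2 * (n - m) : ℂ) • anharmonicA (m + n : ℕ) (m + n : ℕ) 0 := by
  refine derivation_ext fun j => ?_
  fin_cases j <;>
  · simp only [Fin.zero_eta, Fin.mk_one, Derivation.commutator_apply, Derivation.smul_apply,
      Derivation.leibniz, anharmonicA_zero_X_zero, anharmonicA_zero_X_one, anharmonicA_zero_pow,
      smul_eq_mul, smul_eq_C_mul, C_mul, C_sub, map_ofNat, map_natCast]
    ring

theorem lie_anharmonicA_zero_one (m n : ℕ) :
    ⁅anharmonicA m m 0, anharmonicA n n 1⁆ =
      (2 * n : ℂ) • anharmonicA (m + n : ℕ) (m + n : ℕ) 1 := by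
  refine derivation_ext fun j => ?_
  fin_cases j <;>
  · simp only [Fin.zero_eta, Fin.mk_one, Derivation.commutator_apply, Derivation.smul_apply,
      Derivation.leibniz, anharmonicA_zero_X_zero, anharmonicA_zero_X_one, anharmonicA_zero_pow,
      anharmonicA_one_X_zero, anharmonicA_one_X_one, anharmonicA_one_pow, derivation_C, map_neg,
      smul_eq_mul, smul_eq_C_mul, C_mul, map_ofNat, map_natCast]
    ring

theorem lie_anharmonicA_one_one (m n : ℕ) :
    ⁅anharmonicA m m 1, anharmonicA n n 1⁆ = 0 := by
  refine derivation_ext fun j => ?_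
  fin_cases j <;>
  · simp only [Fin.zero_eta, Fin.mk_one, Derivation.commutator_apply, Derivation.zero_apply,
      Derivation.leibniz, anharmonicA_one_X_zero, anharmonicA_one_X_one, anharmonicA_one_pow,
      derivation_C, map_neg, smul_eq_mul]
    ring

/-- If a submodule contains the brackets of generators of two spans, it contains the brackets of
all their elements. -/
theorem lie_mem_of_mem_span {R L : Type*} [CommRing R] [LieRing L] [LieAlgebra R L]
    {s t : Set L} {N : Submodule R L} (h : ∀ x ∈ s, ∀ y ∈ t, ⁅x, y⁆ ∈ N) :
    ∀ x ∈ Submodule.span R s, ∀ y ∈ Submodule.span R t, ⁅x, y⁆ ∈ N := by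
  intro x hx y hy
  induction hx, hy using Submodule.span_induction₂ with
  | mem_mem x y hx hy => exact h x hx y hy
  | zero_left y hy => simp
  | zero_right x hx => simp
  | add_left x y z _ _ _ hx hy => rw [add_lie]; exact N.add_mem hx hy
  | add_right x y z _ _ _ hx hy => rw [lie_add]; exact N.add_mem hx hy
  | smul_left r x y _ _ h => rw [smul_lie]; exact N.smul_mem r h
  | smul_right r x y _ _ h => rw [lie_smul]; exact N.smul_mem r h

/-- The span of the `A(m,m,q)`, `q ∈ {0,1}`, is a Lie subalgebra of the derivations of
`ℂ[x,y]`, and the span of the `A(m,m,1)` is an abelian Lie ideal in it. -/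
theorem stmt_14 :
    (∀ x ∈ Submodule.span ℂ
        {w : Derivation ℂ (MvPolynomial (Fin 2) ℂ) (MvPolynomial (Fin 2) ℂ) |
          ∃ m : ℕ, ∃ q : ℤ, (q = 0 ∨ q = 1) ∧ w = anharmonicA m m q},
      ∀ y ∈ Submodule.span ℂ
        {w : Derivation ℂ (MvPolynomial (Fin 2) ℂ) (MvPolynomial (Fin 2) ℂ) |
          ∃ m : ℕ, ∃ q : ℤ, (q = 0 ∨ q = 1) ∧ w = anharmonicA m m q},
      ⁅x, y⁆ ∈ Submodule.span ℂ
        {w : Derivation ℂ (MvPolynomial (Fin 2) ℂ) (MvPolynomial (Fin 2) ℂ) |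
          ∃ m : ℕ, ∃ q : ℤ, (q = 0 ∨ q = 1) ∧ w = anharmonicA m m q}) ∧
    (∀ x ∈ Submodule.span ℂ
        {w : Derivation ℂ (MvPolynomial (Fin 2) ℂ) (MvPolynomial (Fin 2) ℂ) |
          ∃ m : ℕ, w = anharmonicA m m 1},
      ∀ y ∈ Submodule.span ℂ
        {w : Derivation ℂ (MvPolynomial (Fin 2) ℂ) (MvPolynomial (Fin 2) ℂ) |
          ∃ m : ℕ, w = anharmonicA m m 1},
      ⁅x, y⁆ = 0) ∧
    (∀ x ∈ Submodule.span ℂ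
        {w : Derivation ℂ (MvPolynomial (Fin 2) ℂ) (MvPolynomial (Fin 2) ℂ) |
          ∃ m : ℕ, ∃ q : ℤ, (q = 0 ∨ q = 1) ∧ w = anharmonicA m m q},
      ∀ y ∈ Submodule.span ℂ
        {w : Derivation ℂ (MvPolynomial (Fin 2) ℂ) (MvPolynomial (Fin 2) ℂ) |
          ∃ m : ℕ, w = anharmonicA m m 1},
      ⁅x, y⁆ ∈ Submodule.span ℂ
        {w : Derivation ℂ (MvPolynomial (Fin 2) ℂ) (MvPolynomial (Fin 2) ℂ) |
          ∃ m : ℕ, w = anharmonicA m m 1}) := by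
  refine ⟨lie_mem_of_mem_span ?_, fun x hx y hy => ?_, lie_mem_of_mem_span ?_⟩
  · rintro _ ⟨m, q, rfl | rfl, rfl⟩ _ ⟨n, r, rfl | rfl, rfl⟩
    · rw [lie_anharmonicA_zero_zero]
      exact Submodule.smul_mem _ _ (Submodule.subset_span ⟨_, 0, .inl rfl, rfl⟩)
    · rw [lie_anharmonicA_zero_one]
      exact Submodule.smul_mem _ _ (Submodule.subset_span ⟨_, 1, .inr rfl, rfl⟩)
    · rw [← lie_skew, lie_anharmonicA_zero_one]
      exact Submodule.neg_mem _
        (Submodule.smul_mem _ _ (Submodule.subset_span ⟨_, 1, .inr rfl, rfl⟩))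
    · rw [lie_anharmonicA_one_one]
      exact Submodule.zero_mem _
  · refine (Submodule.mem_bot ℂ).1 (lie_mem_of_mem_span ?_ x hx y hy)
    rintro _ ⟨m, rfl⟩ _ ⟨n, rfl⟩
    exact (Submodule.mem_bot ℂ).2 (lie_anharmonicA_one_one m n)
  · rintro _ ⟨m, q, rfl | rfl, rfl⟩ _ ⟨n, rfl⟩
    · rw [lie_anharmonicA_zero_one]
      exact Submodule.smul_mem _ _ (Submodule.subset_span ⟨_, rfl⟩)
    · rw [lie_anharmonicA_one_one]
      exact Submodule.zero_mem _
end
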